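/- arXiv:math/0106059 — 10 statements merged into one kernel-verified Lean document; each statement's English description precedes it below -/
import Mathlib

section
/- Let L be a complete lattice. Then the collection DI(L) of distributive ideals of L, ordered by inclusion, is a complete lattice in which the infimum of any family of distributive ideals is their intersection and the supremum of any family is 𝒞 applied to their union; in particular, 𝒞(A) is a distributive ideal for every subset A ⊆ L, and L itself is a distributive ideal (the top element of DI(L)). -/
/-- A subset `S` of a complete lattice is distributive if every element `b`
distributes over its supremum: `b ⊓ sSup S = sSup {b ⊓ s | s ∈ S}`. -/
def IsDistribSet {L : Type*} [CompleteLattice L] (S : Set L) : Prop :=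
  ∀ b : L, b ⊓ sSup S = sSup ((fun s => b ⊓ s) '' S)

/-- A distributive ideal: a nonempty lower set closed under suprema of
distributive subsets. -/
def IsDistribIdeal {L : Type*} [CompleteLattice L] (I : Set L) : Prop :=
  I.Nonempty ∧ IsLowerSet I ∧ ∀ S ⊆ I, IsDistribSet S → sSup S ∈ I

/-- `𝒞 A`: the intersection of all distributive ideals containing `A`. -/
def DIcl {L : Type*} [CompleteLattice L] (A : Set L) : Set L :=
  ⋂₀ {I : Set L | IsDistribIdeal I ∧ A ⊆ I}

theorem isDistribIdeal_sInter_aux {L : Type*} [CompleteLattice L] (F : Set (Set L))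
    (h : ∀ I ∈ F, IsDistribIdeal I) : IsDistribIdeal (⋂₀ F) := by
  refine ⟨⟨⊥, fun I hI => ?_⟩, fun a b hab ha I hI => (h I hI).2.1 hab (ha I hI),
    fun S hS hd I hI => (h I hI).2.2 S (fun x hx => hS hx I hI) hd⟩
  obtain ⟨x, hx⟩ := (h I hI).1
  exact (h I hI).2.1 bot_le hx

/-- The distributive ideals of a complete lattice `L`, ordered by inclusion,
form a complete lattice: `L` itself (i.e. `Set.univ`) is a distributive ideal and
the top element; `𝒞 A` is a distributive ideal for every `A ⊆ L`; the intersection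
of any family of distributive ideals is a distributive ideal and is their greatest
lower bound among distributive ideals; and `𝒞` of the union of any family of
distributive ideals is a distributive ideal and is their least upper bound among
distributive ideals. -/
theorem DI_completeLattice {L : Type*} [CompleteLattice L] :
    IsDistribIdeal (Set.univ : Set L) ∧
    (∀ I : Set L, IsDistribIdeal I → I ⊆ Set.univ) ∧
    (∀ A : Set L, IsDistribIdeal (DIcl A) ∧ A ⊆ DIcl A ∧
      ∀ I : Set L, IsDistribIdeal I → A ⊆ I → DIcl A ⊆ I) ∧
    (∀ 𝒜 : Set (Set L), (∀ I ∈ 𝒜, IsDistribIdeal I) →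
      (IsDistribIdeal (⋂₀ 𝒜) ∧
        (∀ I ∈ 𝒜, ⋂₀ 𝒜 ⊆ I) ∧
        (∀ J : Set L, IsDistribIdeal J → (∀ I ∈ 𝒜, J ⊆ I) → J ⊆ ⋂₀ 𝒜)) ∧
      (IsDistribIdeal (DIcl (⋃₀ 𝒜)) ∧
        (∀ I ∈ 𝒜, I ⊆ DIcl (⋃₀ 𝒜)) ∧
        (∀ J : Set L, IsDistribIdeal J → (∀ I ∈ 𝒜, I ⊆ J) → DIcl (⋃₀ 𝒜) ⊆ J))) := by
  have hc : ∀ A : Set L, IsDistribIdeal (DIcl A) := fun A =>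
    isDistribIdeal_sInter_aux _ fun I hI => hI.1
  have hs : ∀ A : Set L, A ⊆ DIcl A := fun A x hx I hI => hI.2 hx
  have hm : ∀ A I : Set L, IsDistribIdeal I → A ⊆ I → DIcl A ⊆ I :=
    fun A I hI hA x hx => hx I ⟨hI, hA⟩
  refine ⟨⟨⟨⊥, trivial⟩, fun _ _ _ _ => trivial, fun _ _ _ => trivial⟩,
    fun I _ => Set.subset_univ I, fun A => ⟨hc A, hs A, hm A⟩, fun F hF => ⟨⟨?_, ?_, ?_⟩, ?_, ?_, ?_⟩⟩
  · exact isDistribIdeal_sInter_aux F hF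
  · exact fun I hI => Set.sInter_subset_of_mem hI
  · exact fun J _ h => Set.subset_sInter h
  · exact hc _
  · exact fun I hI => (Set.subset_sUnion_of_mem hI).trans (hs _)
  · exact fun J hJ h => hm _ J hJ (Set.sUnion_subset h)
end

section
/- Let L be a complete lattice. Then DI(L) is a frame (complete Heyting algebra): for every distributive ideal A ∈ DI(L) and every family {B_i}_{i ∈ I} of distributive ideals, A ∩ 𝒞(⋃_{i∈I} B_i) = 𝒞(⋃_{i∈I} (A ∩ B_i)); that is, binary meets (intersections) in DI(L) distribute over arbitrary joins (given by 𝒞 of unions). -/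
theorem DIcl_ideal {L : Type*} [CompleteLattice L] (A : Set L) : IsDistribIdeal (DIcl A) := by
  refine ⟨⟨⊥, ?_⟩, ?_, ?_⟩
  · rintro I ⟨⟨⟨x, hx⟩, hl, _⟩, _⟩
    exact hl bot_le hx
  · intro a b hba ha I hI
    exact hI.1.2.1 hba (ha I hI)
  · intro S hS hd I hI
    exact hI.1.2.2 S (fun s hs => hS hs I hI) hd

theorem IsDistribSet.inf_image {L : Type*} [CompleteLattice L] {S : Set L} (h : IsDistribSet S)
    (a : L) : IsDistribSet ((fun s => a ⊓ s) '' S) := by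
  intro b
  rw [← h a, ← inf_assoc, h (b ⊓ a), Set.image_image]
  simp only [inf_assoc]

/-- `DI(L)` is a frame: binary meets distribute over arbitrary joins,
where joins are given by `𝒞` of unions. -/
theorem DI_frame {L : Type*} [CompleteLattice L]
    (A : Set L) (hA : IsDistribIdeal A)
    {ι : Type*} (B : ι → Set L) (hB : ∀ i, IsDistribIdeal (B i)) :
    A ∩ DIcl (⋃ i, B i) = DIcl (⋃ i, A ∩ B i) := by
  apply Set.Subset.antisymm
  · rintro x ⟨hxA, hx⟩
    have hK := DIcl_ideal (⋃ i, A ∩ B i)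
    have hJ : x ∈ {y | ∀ a ∈ A, a ⊓ y ∈ DIcl (⋃ i, A ∩ B i)} := by
      apply hx
      refine ⟨⟨?_, ?_, ?_⟩, ?_⟩
      · obtain ⟨z, hz⟩ := hK.1
        exact ⟨z, fun a _ => hK.2.1 inf_le_right hz⟩
      · intro y z hzy hy a ha
        exact hK.2.1 (inf_le_inf_left a hzy) (hy a ha)
      · intro S hS hd a ha
        rw [hd a]
        refine hK.2.2 _ ?_ (hd.inf_image a)
        rintro _ ⟨s, hs, rfl⟩
        exact hS hs a ha
      · intro y hy a ha
        obtain ⟨i, hi⟩ := Set.mem_iUnion.1 hy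
        intro I hI
        exact hI.2 (Set.mem_iUnion.2
          ⟨i, hA.2.1 inf_le_left ha, (hB i).2.1 inf_le_right hi⟩)
    simpa using hJ x hxA
  · intro x hx
    refine ⟨hx A ⟨hA, Set.iUnion_subset fun i => Set.inter_subset_left⟩, ?_⟩
    intro I hI
    exact hx I ⟨hI.1, (Set.iUnion_mono fun i => Set.inter_subset_right).trans hI.2⟩
end

section
/- Let L be a complete lattice. For every a ∈ L the principal ideal ↓a is a distributive ideal, and the map a ↦ ↓a is an order embedding of L into DI(L) (↓a ⊆ ↓b if and only if a ≤ b, hence it is injective) which preserves arbitrary meets, i.e. ↓(sInf T) = ⋂_{a∈T} ↓a for every T ⊆ L, and preserves distributive joins, i.e. for every distributive subset S ⊆ L one has ↓(sSup S) = 𝒞(⋃_{a∈S} ↓a), the supremum of {↓a | a ∈ S} in DI(L). -/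
/-- Principal ideals `↓a` are distributive ideals, and `a ↦ ↓a` is an order
embedding of `L` into `DI(L)` preserving arbitrary meets and distributive joins. -/
theorem principal_ideal_embedding {L : Type*} [CompleteLattice L] :
    (∀ a : L, IsDistribIdeal (Set.Iic a)) ∧
    (∀ a b : L, Set.Iic a ⊆ Set.Iic b ↔ a ≤ b) ∧
    Function.Injective (fun a : L => Set.Iic a) ∧
    (∀ T : Set L, Set.Iic (sInf T) = ⋂ a ∈ T, Set.Iic a) ∧
    (∀ S : Set L, IsDistribSet S → Set.Iic (sSup S) = DIcl (⋃ a ∈ S, Set.Iic a)) := by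
  have h1 : ∀ a : L, IsDistribIdeal (Set.Iic a) := fun a =>
    ⟨⟨a, le_refl a⟩, isLowerSet_Iic a, fun S hS _ => sSup_le fun s hs => hS hs⟩
  refine ⟨h1, fun a b => Set.Iic_subset_Iic, ?_, ?_, ?_⟩
  · intro a b h
    exact le_antisymm (Set.Iic_subset_Iic.1 (le_of_eq h)) (Set.Iic_subset_Iic.1 (le_of_eq h.symm))
  · intro T
    ext x
    simp [le_sInf_iff]
  · intro S hS
    apply Set.Subset.antisymm
    · rintro x hx I ⟨hI, hA⟩
      refine hI.2.1 hx (hI.2.2 S (fun s hs => hA ?_) hS)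
      exact Set.mem_biUnion hs (le_refl s)
    · intro x hx
      refine hx (Set.Iic (sSup S)) ⟨h1 _, ?_⟩
      exact Set.iUnion₂_subset fun a ha => Set.Iic_subset_Iic.2 (le_sSup ha)
end

section
/- Let L be a complete lattice and A, B ∈ DI(L). Then the set H = {a ∈ L | a ⊓ b ∈ B for all b ∈ A} is a distributive ideal, it coincides with {c ∈ L | for all d ≤ c, d ∈ A implies d ∈ B}, and it is the Heyting implication of A and B in the frame DI(L): for every C ∈ DI(L), C ∩ A ⊆ B if and only if C ⊆ H. -/
/-- The Heyting implication in the frame `DI(L)`. -/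
theorem DI_heyting_implication {L : Type*} [CompleteLattice L]
    (A B : Set L) (hA : IsDistribIdeal A) (hB : IsDistribIdeal B) :
    IsDistribIdeal {a : L | ∀ b ∈ A, a ⊓ b ∈ B} ∧
    {a : L | ∀ b ∈ A, a ⊓ b ∈ B} = {c : L | ∀ d ≤ c, d ∈ A → d ∈ B} ∧
    (∀ C : Set L, IsDistribIdeal C →
      (C ∩ A ⊆ B ↔ C ⊆ {a : L | ∀ b ∈ A, a ⊓ b ∈ B})) := by
  obtain ⟨hAn, hAl, hAs⟩ := hA
  obtain ⟨⟨x, hx⟩, hBl, hBs⟩ := hB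
  refine ⟨⟨⟨x, fun b _ => hBl inf_le_left hx⟩, ?_, ?_⟩, ?_, ?_⟩
  · intro a c hca ha b hb
    exact hBl (inf_le_inf_right b hca) (ha b hb)
  · intro S hS hd b hb
    rw [inf_comm, hd b]
    apply hBs
    · rintro _ ⟨s, hs, rfl⟩
      have := hS hs b hb
      rw [inf_comm] at this
      exact this
    · intro c
      rw [← hd b, ← inf_assoc, hd (c ⊓ b), Set.image_image]
      simp only [inf_assoc]
  · ext c
    constructor
    · intro h d hdc hdA
      have := h d hdA
      rwa [inf_eq_right.mpr hdc] at this
    · intro h b hb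
      exact h _ inf_le_left (hAl inf_le_right hb)
  · intro C hC
    constructor
    · intro h c hc b hb
      exact h ⟨hC.2.1 inf_le_left hc, hAl inf_le_right hb⟩
    · rintro h c ⟨hc, hcA⟩
      have := h hc c hcA
      rwa [inf_idem] at this
end

section
/- (Propagation adjunction.) Let L be a complete lattice, let ê^*, ê_* : DI(L) → DI(L) form a Galois adjunction, and let A, B ∈ DI(L). Define the dynamic propagation implication (A →ᵉ B) = {c ∈ L | for all d ≤ c, d ∈ A implies ê^*(↓d) ⊆ B}. Then (A →ᵉ B) is a distributive ideal and for every X ∈ DI(L): ê^*(X ∩ A) ⊆ B if and only if X ⊆ (A →ᵉ B); that is, X ↦ ê^*(X ∩ A) is left adjoint to X ↦ (A →ᵉ X). -/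
/-- Propagation adjunction: the dynamic propagation implication
`(A →ᵉ B) = {c | ∀ d ≤ c, d ∈ A → ê^*(↓d) ⊆ B}` is a distributive ideal and
`X ↦ ê^*(X ∩ A)` is left adjoint to `X ↦ (A →ᵉ X)` on `DI(L)`. -/
theorem propagation_adjunction {L : Type*} [CompleteLattice L]
    (es ec : Set L → Set L)
    (hes : ∀ X : Set L, IsDistribIdeal X → IsDistribIdeal (es X))
    (hec : ∀ Y : Set L, IsDistribIdeal Y → IsDistribIdeal (ec Y))
    (hadj : ∀ X Y : Set L, IsDistribIdeal X → IsDistribIdeal Y →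
      (es X ⊆ Y ↔ X ⊆ ec Y))
    (A B : Set L) (hA : IsDistribIdeal A) (hB : IsDistribIdeal B) :
    IsDistribIdeal {c : L | ∀ d ≤ c, d ∈ A → es (Set.Iic d) ⊆ B} ∧
    (∀ X : Set L, IsDistribIdeal X →
      (es (X ∩ A) ⊆ B ↔ X ⊆ {c : L | ∀ d ≤ c, d ∈ A → es (Set.Iic d) ⊆ B})) := by
  have key : ∀ d : L, es (Set.Iic d) ⊆ B ↔ d ∈ ec B := by
    intro d
    have hd : IsDistribIdeal (Set.Iic d) :=
      ⟨⟨d, le_refl d⟩, isLowerSet_Iic d, fun S hS _ => sSup_le fun s hs => hS hs⟩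
    rw [hadj _ _ hd hB]
    exact ⟨fun h => h (le_refl d), fun h x hx => (hec B hB).2.1 hx h⟩
  simp only [key]
  obtain ⟨⟨c0, hc0⟩, hCl, hCs⟩ := hec B hB
  refine ⟨⟨⟨c0, fun d hd _ => hCl hd hc0⟩, fun a b hba ha d hd => ha d (hd.trans hba), ?_⟩, ?_⟩
  · intro S hS hSd d hd hdA
    have h1 : d = sSup ((fun s => d ⊓ s) '' S) := by
      rw [← hSd d]; exact (inf_eq_left.mpr hd).symm
    rw [h1]
    apply hCs
    · rintro _ ⟨s, hs, rfl⟩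
      exact hS hs _ inf_le_right (hA.2.1 inf_le_left hdA)
    · intro b
      rw [← hSd d, ← inf_assoc, hSd (b ⊓ d), Set.image_image]
      simp only [inf_assoc]
  · intro X hX
    have hXA : IsDistribIdeal (X ∩ A) := by
      obtain ⟨⟨x, hx⟩, hXl, hXs⟩ := hX
      obtain ⟨⟨a, ha⟩, hAl, hAs⟩ := hA
      exact ⟨⟨x ⊓ a, hXl inf_le_left hx, hAl inf_le_right ha⟩, hXl.inter hAl,
        fun S hS hd => ⟨hXs S (fun s hs => (hS hs).1) hd, hAs S (fun s hs => (hS hs).2) hd⟩⟩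
    rw [hadj _ _ hXA hB]
    exact ⟨fun h c hc d hd hdA => h ⟨hX.2.1 hd hc, hdA⟩,
      fun h x hx => h hx.1 x le_rfl hx.2⟩
end

section
/- (Strengthened law of entailment for propagation.) Let L be a complete lattice, let ê^*, ê_* : DI(L) → DI(L) form a Galois adjunction, and let A, B ∈ DI(L). Then {c ∈ L | for all d ≤ c, d ∈ A implies ê^*(↓d) ⊆ B} = L if and only if ê^*(A) ⊆ B. -/
/-- Strengthened law of entailment for propagation: the propagation implication
`(A →ᵉ B)` equals all of `L` iff `ê^*(A) ⊆ B`, i.e. iff `A ⤳ᵉ B`. -/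
theorem propagation_entailment {L : Type*} [CompleteLattice L]
    (es ec : Set L → Set L)
    (hes : ∀ X : Set L, IsDistribIdeal X → IsDistribIdeal (es X))
    (hec : ∀ Y : Set L, IsDistribIdeal Y → IsDistribIdeal (ec Y))
    (hadj : ∀ X Y : Set L, IsDistribIdeal X → IsDistribIdeal Y →
      (es X ⊆ Y ↔ X ⊆ ec Y))
    (A B : Set L) (hA : IsDistribIdeal A) (hB : IsDistribIdeal B) :
    {c : L | ∀ d ≤ c, d ∈ A → es (Set.Iic d) ⊆ B} = Set.univ ↔ es A ⊆ B := by
  have hI : ∀ d : L, IsDistribIdeal (Set.Iic d) := fun d =>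
    ⟨⟨d, le_refl d⟩, isLowerSet_Iic d, fun S hS _ => sSup_le fun s hs => hS hs⟩
  constructor
  · intro h
    rw [hadj A B hA hB]
    intro d hd
    have h1 : d ∈ {c : L | ∀ d ≤ c, d ∈ A → es (Set.Iic d) ⊆ B} := by
      rw [h]; trivial
    exact (hadj _ B (hI d) hB).1 (h1 d le_rfl hd) (le_refl d)
  · intro h
    rw [Set.eq_univ_iff_forall]
    intro c d _ hd
    rw [hadj _ B (hI d) hB]
    exact fun x hx => (hadj A B hA hB).1 h (hA.2.1 hx hd)
end

section
/- (Causation adjunction.) Let L be a complete lattice, let ê^*, ê_* : DI(L) → DI(L) form a Galois adjunction, and let A, B ∈ DI(L). Define the dynamic causation implication (A ←ᵉ B) = {c ∈ L | for all d ≤ c, ê^*(↓d) ⊆ B implies d ∈ A}. Then (A ←ᵉ B) is a distributive ideal and for every X ∈ DI(L): X ∩ ê_*(B) ⊆ A if and only if X ⊆ (A ←ᵉ B); that is, X ↦ X ∩ ê_*(B) is left adjoint to X ↦ (X ←ᵉ B). -/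
/-- Causation adjunction: the dynamic causation implication
`(A ←ᵉ B) = {c | ∀ d ≤ c, ê^*(↓d) ⊆ B → d ∈ A}` is a distributive ideal and
`X ↦ X ∩ ê_*(B)` is left adjoint to `X ↦ (X ←ᵉ B)` on `DI(L)`. -/
theorem causation_adjunction {L : Type*} [CompleteLattice L]
    (es ec : Set L → Set L)
    (hes : ∀ X : Set L, IsDistribIdeal X → IsDistribIdeal (es X))
    (hec : ∀ Y : Set L, IsDistribIdeal Y → IsDistribIdeal (ec Y))
    (hadj : ∀ X Y : Set L, IsDistribIdeal X → IsDistribIdeal Y →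
      (es X ⊆ Y ↔ X ⊆ ec Y))
    (A B : Set L) (hA : IsDistribIdeal A) (hB : IsDistribIdeal B) :
    IsDistribIdeal {c : L | ∀ d ≤ c, es (Set.Iic d) ⊆ B → d ∈ A} ∧
    (∀ X : Set L, IsDistribIdeal X →
      (X ∩ ec B ⊆ A ↔ X ⊆ {c : L | ∀ d ≤ c, es (Set.Iic d) ⊆ B → d ∈ A})) := by
  have hI : ∀ d : L, IsDistribIdeal (Set.Iic d) := fun d =>
    ⟨⟨d, le_refl d⟩, isLowerSet_Iic d, fun S hS _ => sSup_le fun s hs => hS hs⟩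
  have hE := hec B hB
  have key : ∀ d : L, es (Set.Iic d) ⊆ B ↔ d ∈ ec B := fun d => by
    rw [hadj _ _ (hI d) hB]
    exact ⟨fun h => h (le_refl d), fun h x hx => hE.2.1 hx h⟩
  simp only [key]
  refine ⟨⟨⟨⊥, ?_⟩, ?_, ?_⟩, ?_⟩
  · intro d hd _
    obtain ⟨a, ha⟩ := hA.1
    exact hA.2.1 (hd.trans bot_le) ha
  · intro a b hba ha d hd h
    exact ha d (hd.trans hba) h
  · intro S hS hD d hd h
    have e : d = sSup ((fun s => d ⊓ s) '' S) := by
      rw [← hD d, inf_eq_left.2 hd]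
    rw [e]
    refine hA.2.2 _ ?_ ?_
    · rintro _ ⟨s, hs, rfl⟩
      exact hS hs _ inf_le_right (hE.2.1 inf_le_left h)
    · intro b
      rw [← hD d, ← inf_assoc, hD (b ⊓ d), Set.image_image]
      simp only [inf_assoc]
  · intro X hX
    exact ⟨fun h c hc d hd hdB => h ⟨hX.2.1 hd hc, hdB⟩,
      fun h c hc => h hc.1 c le_rfl hc.2⟩
end

section
/- (Strengthened law of entailment for causation.) Let L be a complete lattice, let ê^*, ê_* : DI(L) → DI(L) form a Galois adjunction, and let A, B ∈ DI(L). Then {c ∈ L | for all d ≤ c, ê^*(↓d) ⊆ B implies d ∈ A} = L if and only if ê_*(B) ⊆ A. -/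
/-- Strengthened law of entailment for causation: the causation implication
`(A ←ᵉ B)` equals all of `L` iff `ê_*(B) ⊆ A`, i.e. iff `A ⟲ᵉ B`. -/
theorem causation_entailment {L : Type*} [CompleteLattice L]
    (es ec : Set L → Set L)
    (hes : ∀ X : Set L, IsDistribIdeal X → IsDistribIdeal (es X))
    (hec : ∀ Y : Set L, IsDistribIdeal Y → IsDistribIdeal (ec Y))
    (hadj : ∀ X Y : Set L, IsDistribIdeal X → IsDistribIdeal Y →
      (es X ⊆ Y ↔ X ⊆ ec Y))
    (A B : Set L) (hA : IsDistribIdeal A) (hB : IsDistribIdeal B) :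
    {c : L | ∀ d ≤ c, es (Set.Iic d) ⊆ B → d ∈ A} = Set.univ ↔ ec B ⊆ A := by
  have hI : ∀ d : L, IsDistribIdeal (Set.Iic d) := fun d =>
    ⟨⟨d, le_refl d⟩, isLowerSet_Iic d, fun S hS _ => sSup_le fun s hs => hS hs⟩
  constructor
  · intro h d hd
    have hu : d ∈ {c : L | ∀ d ≤ c, es (Set.Iic d) ⊆ B → d ∈ A} := by
      rw [h]; trivial
    exact hu d le_rfl ((hadj _ _ (hI d) hB).2 fun x hx => (hec B hB).2.1 hx hd)
  · intro h
    refine Set.eq_univ_of_forall fun c d _ hd => ?_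
    exact h ((hadj _ _ (hI d) hB).1 hd (le_refl d))
end

section
/- (Sasaki adjunction is equivalent to orthomodularity.) Let L be an ortholattice, i.e. a lattice with bottom ⊥ and top ⊤ equipped with a map ′ : L → L satisfying a ⊓ a′ = ⊥, a ≤ b → b′ ≤ a′, and a″ = a for all a, b ∈ L. Then the following are equivalent: (i) L is orthomodular, i.e. a ≤ b implies b = a ⊔ (a′ ⊓ b) for all a, b ∈ L; (ii) for every a ∈ L, the Sasaki projection b ↦ a ⊓ (a′ ⊔ b) is left adjoint to the Sasaki hook c ↦ a′ ⊔ (a ⊓ c), i.e. for all b, c ∈ L: a ⊓ (a′ ⊔ b) ≤ c if and only if b ≤ a′ ⊔ (a ⊓ c). -/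
/-- Sasaki adjunction is equivalent to orthomodularity: in an ortholattice `L`
with orthocomplementation `compl`, `L` is orthomodular iff, for every `a`, the
Sasaki projection `b ↦ a ⊓ (a′ ⊔ b)` is left adjoint to the Sasaki hook
`c ↦ a′ ⊔ (a ⊓ c)`. -/
theorem orthomodular_iff_sasaki_adjunction {L : Type*} [Lattice L] [BoundedOrder L]
    (compl : L → L)
    (h1 : ∀ a : L, a ⊓ compl a = ⊥)
    (h2 : ∀ a b : L, a ≤ b → compl b ≤ compl a)
    (h3 : ∀ a : L, compl (compl a) = a) :
    (∀ a b : L, a ≤ b → b = a ⊔ (compl a ⊓ b)) ↔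
    (∀ a b c : L, a ⊓ (compl a ⊔ b) ≤ c ↔ b ≤ compl a ⊔ (a ⊓ c)) := by
  constructor
  · intro om a b c
    constructor
    · intro h
      have e := om (compl a) (compl a ⊔ b) le_sup_left
      rw [h3] at e
      calc b ≤ compl a ⊔ b := le_sup_right
        _ = compl a ⊔ (a ⊓ (compl a ⊔ b)) := e
        _ ≤ compl a ⊔ (a ⊓ c) := sup_le_sup_left (le_inf inf_le_left h) _
    · intro h
      have key : ∀ x : L, x ≤ a → a ⊓ (compl a ⊔ x) ≤ x := by
        intro x hx
        have e := om (compl a) (compl x) (h2 _ _ hx)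
        rw [h3] at e
        have g : compl x ≤ compl (a ⊓ (compl a ⊔ x)) := by
          rw [e]
          refine sup_le (h2 _ _ inf_le_left) ?_
          have k : a ⊓ (compl a ⊔ x) ≤ compl (a ⊓ compl x) := by
            refine inf_le_right.trans (sup_le (h2 _ _ inf_le_left) ?_)
            have := h2 (a ⊓ compl x) (compl x) inf_le_right
            rwa [h3] at this
          have := h2 _ _ k
          rwa [h3] at this
        have := h2 _ _ g
        rwa [h3, h3] at this
      calc a ⊓ (compl a ⊔ b) ≤ a ⊓ (compl a ⊔ (a ⊓ c)) :=
            inf_le_inf_left _ (sup_le le_sup_left h)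
        _ ≤ a ⊓ c := key _ inf_le_left
        _ ≤ c := inf_le_right
  · intro adj a b hab
    apply le_antisymm
    · have := (adj (compl a) b b).1
      rw [h3, sup_eq_right.2 hab] at this
      exact this inf_le_right
    · exact sup_le hab inf_le_right
end

section
/- (Relational inverses do not preserve physical continuity.) Let Σ = {p, q, r, s} be a four-element set, let 𝒮 = {∅, {p}, {q}, {r}, {s}, {q,r,s}, Σ} and define the closure cl(T) = ⋂ {C ∈ 𝒮 | T ⊆ C} for T ⊆ Σ. Let h : Σ → P(Σ) be given by h(p) = {p,q}, h(q) = {q}, h(r) = {r}, h(s) = {s}, extended to ĥ(A) = ⋃_{x ∈ A} h(x), and let the inverse-relation map be inv(A) = {x ∈ Σ | h(x) ∩ A ≠ ∅}. Then: (a) ĥ satisfies the continuity condition: for all A, B ⊆ Σ, cl(A) = cl(B) implies cl(ĥ(A)) = cl(ĥ(B)); but (b) inv does not: cl({q,r}) = cl({r,s}) while cl(inv({q,r})) ≠ cl(inv({r,s})) (indeed cl(inv({q,r})) = Σ whereas cl(inv({r,s})) = {q,r,s}). -/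
/-- The states `p, q, r, s` are `0, 1, 2, 3 : Fin 4`; the family of closed
subsets is `{∅, {p}, {q}, {r}, {s}, {q,r,s}, Σ}`. -/
def closedSets : Set (Set (Fin 4)) :=
  {∅, {0}, {1}, {2}, {3}, {1, 2, 3}, Set.univ}

/-- The closure operator associated with `closedSets`. -/
def cl (T : Set (Fin 4)) : Set (Fin 4) :=
  ⋂₀ {C : Set (Fin 4) | C ∈ closedSets ∧ T ⊆ C}

/-- The transition map on states: `h p = {p,q}`, `h q = {q}`, `h r = {r}`,
`h s = {s}`. -/
def htrans : Fin 4 → Set (Fin 4) :=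
  fun x => if x = 0 then {0, 1} else {x}

/-- The union-preserving extension `ĥ` of `h` to subsets. -/
def hhat (A : Set (Fin 4)) : Set (Fin 4) :=
  ⋃ x ∈ A, htrans x

/-- The map induced by the inverse of the relation associated with `h`. -/
def hinv (A : Set (Fin 4)) : Set (Fin 4) :=
  {x : Fin 4 | (htrans x ∩ A).Nonempty}

theorem subset_cl_aux (T : Set (Fin 4)) : T ⊆ cl T :=
  Set.subset_sInter fun _ hC => hC.2

theorem pre_closed_aux (C : Set (Fin 4)) (hC : C ∈ closedSets) :
    {x | htrans x ⊆ C} ∈ closedSets := by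
  have key : ∀ D ∈ closedSets, (∀ x, htrans x ⊆ C ↔ x ∈ D) →
      {x | htrans x ⊆ C} ∈ closedSets := by
    intro D hD h
    have : {x | htrans x ⊆ C} = D := Set.ext h
    rwa [this]
  simp only [closedSets, Set.mem_insert_iff, Set.mem_singleton_iff] at hC
  rcases hC with rfl | rfl | rfl | rfl | rfl | rfl | rfl
  · refine key ∅ (by simp [closedSets]) fun x => ?_
    fin_cases x <;> simp [htrans]
    exact (Set.insert_nonempty _ _).ne_empty
  · refine key ∅ (by simp [closedSets]) fun x => ?_
    fin_cases x <;> simp [htrans, Set.insert_subset_iff]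
  · refine key {1} (by simp [closedSets]) fun x => ?_
    fin_cases x <;> simp [htrans, Set.insert_subset_iff]
  · refine key {2} (by simp [closedSets]) fun x => ?_
    fin_cases x <;> simp [htrans, Set.insert_subset_iff]
  · refine key {3} (by simp [closedSets]) fun x => ?_
    fin_cases x <;> simp [htrans, Set.insert_subset_iff]
  · refine key {1, 2, 3} (by simp [closedSets]) fun x => ?_
    fin_cases x <;> simp [htrans, Set.insert_subset_iff]
  · refine key Set.univ (by simp [closedSets]) fun x => ?_
    simp

theorem hhat_sub_aux (A B C : Set (Fin 4)) (h : cl A = cl B) (hC : C ∈ closedSets)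
    (hA : hhat A ⊆ C) : hhat B ⊆ C := by
  have h1 : A ⊆ {x | htrans x ⊆ C} := fun x hx => Set.iUnion₂_subset_iff.1 hA x hx
  have h2 : cl A ⊆ {x | htrans x ⊆ C} := Set.sInter_subset_of_mem ⟨pre_closed_aux C hC, h1⟩
  exact Set.iUnion₂_subset fun x hx => h2 (h ▸ subset_cl_aux B hx)

theorem mem_cl_aux (T : Set (Fin 4)) (x : Fin 4) :
    x ∈ cl T ↔ ∀ C ∈ closedSets, T ⊆ C → x ∈ C := by
  simp [cl]

theorem cl_eq_aux (T D : Set (Fin 4)) (hD : D ∈ closedSets) (hT : T ⊆ D)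
    (h : ∀ C ∈ closedSets, T ⊆ C → D ⊆ C) : cl T = D :=
  Set.Subset.antisymm (Set.sInter_subset_of_mem ⟨hD, hT⟩)
    (Set.subset_sInter fun C hC => h C hC.1 hC.2)

/-- Relational inverses do not preserve physical continuity: `ĥ` satisfies the
continuity condition `cl A = cl B → cl (ĥ A) = cl (ĥ B)`, but the
inverse-relation map does not: `cl {q,r} = cl {r,s}` while
`cl (inv {q,r}) = Σ ≠ {q,r,s} = cl (inv {r,s})`. -/
theorem relational_inverse_not_continuous :
    (∀ A B : Set (Fin 4), cl A = cl B → cl (hhat A) = cl (hhat B)) ∧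
    cl {1, 2} = cl {2, 3} ∧
    cl (hinv {1, 2}) ≠ cl (hinv {2, 3}) ∧
    cl (hinv {1, 2}) = Set.univ ∧
    cl (hinv {2, 3}) = {1, 2, 3} := by
  have e1 : hinv {1, 2} = {0, 1, 2} := by
    ext x
    fin_cases x <;> simp [hinv, htrans, Set.Nonempty]
  have e2 : hinv {2, 3} = {2, 3} := by
    ext x
    fin_cases x <;> simp [hinv, htrans, Set.Nonempty]
  have c1 : cl {1, 2} = {1, 2, 3} := by
    apply cl_eq_aux <;> simp [closedSets, Set.insert_subset_iff]
  have c2 : cl {2, 3} = {1, 2, 3} := by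
    apply cl_eq_aux <;> simp [closedSets, Set.insert_subset_iff]
  have c3 : cl {0, 1, 2} = Set.univ := by
    apply cl_eq_aux <;> simp [closedSets, Set.insert_subset_iff]
  rw [e1, e2, c1, c2, c3]
  refine ⟨fun A B h => ?_, rfl, ?_, rfl, rfl⟩
  · ext x
    rw [mem_cl_aux, mem_cl_aux]
    exact ⟨fun H C hC hB => H C hC (hhat_sub_aux B A C h.symm hC hB),
      fun H C hC hA => H C hC (hhat_sub_aux A B C h hC hA)⟩
  · intro h
    have : (0 : Fin 4) ∈ ({1, 2, 3} : Set (Fin 4)) := h ▸ Set.mem_univ _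
    simp at this
end
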